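/- Let F : ℝ³ × ℝ³ → ℂ be smooth and suppose that on the region Ξ⁺ = {(x,ξ) : |x| ≥ R ⟹ ⟨x/|x|, ξ/|ξ|⟩ ≥ −1+ε₀} (for some R > 0, 0 < ε₀ < 1) one has, for all multi-indices α,β, |∂ₓ^α ∂_ξ^β F(x,ξ)| ≤ C_{α,β}(1+|x|)^{−ρ−|α|}|ξ|^{−|β|} with ρ > 1. Then d(x,ξ) = ∫₀^∞ F(x + tω, ξ) dt (where ω = ξ/|ξ|) converges, satisfies ⟨ω, ∇ₓ d(x,ξ)⟩ = −F(x,ξ), and obeys |∂ₓ^α ∂_ξ^β d(x,ξ)| ≤ C'_{α,β}(1+|x|)^{−(ρ−1)−|α|}|ξ|^{−|β|} on Ξ⁺. -/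

import Mathlib

open scoped RealInnerProductSpace
open MeasureTheory

universe u

section
open scoped ContDiff

section
variable {E V : Type u} [NormedAddCommGroup E] [NormedSpace ℝ E]
  [NormedAddCommGroup V] [NormedSpace ℝ V]

theorem ContDiffOn.iteratedFDeriv_infty_of_isOpen {f : E → V} {U : Set E} (hU : IsOpen U)
    (hf : ContDiffOn ℝ ∞ f U) (k : ℕ) : ContDiffOn ℝ ∞ (iteratedFDeriv ℝ k f) U :=
  fun _ hx => ((hf.contDiffAt (hU.mem_nhds hx)).iteratedFDeriv_right (i := k) (m := ∞)
    (by exact_mod_cast le_top)).contDiffWithinAt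

/-- Derivatives of the restriction of a smooth function to an affine subspace. -/
theorem iteratedFDeriv_comp_affine {W : Type*} [NormedAddCommGroup W] [NormedSpace ℝ W]
    {f : E → V} {U : Set E} (hU : IsOpen U)
    (hf : ContDiffOn ℝ ∞ f U) (A : W →L[ℝ] E) (a : E) (y : W) (hy : a + A y ∈ U) (k : ℕ) :
    iteratedFDeriv ℝ k (fun y => f (a + A y)) y =
      (iteratedFDeriv ℝ k f (a + A y)).compContinuousLinearMap fun _ => A := by
  set U' : Set E := (fun z => a + z) ⁻¹' U
  have hU' : IsOpen U' := hU.preimage (by fun_prop)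
  have hf' : ContDiffOn ℝ ∞ (fun z => f (a + z)) U' :=
    hf.comp (by fun_prop) (fun z hz => hz)
  have hA : IsOpen (A ⁻¹' U') := hU'.preimage A.continuous
  have h := A.iteratedFDerivWithin_comp_right hf' hU'.uniqueDiffOn hA.uniqueDiffOn
    (x := y) hy (i := k) (by exact_mod_cast le_top)
  rw [iteratedFDerivWithin_of_isOpen k hA hy, iteratedFDerivWithin_of_isOpen k hU' hy,
    iteratedFDeriv_comp_add_left] at h
  exact h

theorem iteratedFDeriv_iteratedFDeriv_apply (f : E → V) (x : E) (n k : ℕ) (v : Fin n → E)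
    (w : Fin k → E) :
    iteratedFDeriv ℝ n (iteratedFDeriv ℝ k f) x v w =
      iteratedFDeriv ℝ (n + k) f x (Fin.append v w) := by
  induction k generalizing V with
  | zero =>
    have : iteratedFDeriv ℝ 0 f =
        (continuousMultilinearCurryFin0 ℝ E V).symm.toContinuousLinearEquiv ∘ f := by
      ext; simp
    rw [this, ContinuousLinearEquiv.iteratedFDeriv_comp_left]
    simp [Fin.append_right_nil]
  | succ k ih =>
    have h1 : iteratedFDeriv ℝ (k + 1) f =
        (continuousMultilinearCurryRightEquiv' ℝ k E V).symm.toContinuousLinearEquiv ∘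
          iteratedFDeriv ℝ k (fderiv ℝ f) := by
      ext1 y
      exact iteratedFDeriv_succ_eq_comp_right
    have h4 := ContinuousLinearEquiv.iteratedFDeriv_comp_left (i := n) (x := x)
      (f := iteratedFDeriv ℝ k (fderiv ℝ f))
      (continuousMultilinearCurryRightEquiv' ℝ k E V).symm.toContinuousLinearEquiv
    rw [h1]
    refine (DFunLike.congr_fun (DFunLike.congr_fun h4 v) w).trans ?_
    have h2 := ih (fderiv ℝ f) (Fin.init w)
    change iteratedFDeriv ℝ n (iteratedFDeriv ℝ k (fderiv ℝ f)) x v (Fin.init w)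
      (w (Fin.last k)) = _
    rw [h2]
    change _ = iteratedFDeriv ℝ ((n + k) + 1) f x (@Fin.append n (k + 1) _ v w)
    rw [iteratedFDeriv_succ_apply_right]
    have h3 : Fin.append v w = Fin.snoc (Fin.append v (Fin.init w)) (w (Fin.last k)) := by
      rw [← Fin.append_snoc, Fin.snoc_init_self]
    rw [h3, Fin.init_snoc]
    congr 1
    exact (Fin.snoc_last (α := fun _ => E) _ _).symm

/-- Iterated derivatives of a smooth function are symmetric. -/
theorem ContDiff.iteratedFDeriv_comp_perm_infty {f : E → V} (hf : ContDiff ℝ ∞ f) (n : ℕ)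
    (σ : Equiv.Perm (Fin n)) (x : E) (v : Fin n → E) :
    iteratedFDeriv ℝ n f x (v ∘ σ) = iteratedFDeriv ℝ n f x v := by
  induction n generalizing x with
  | zero => congr 1; ext i; exact i.elim0
  | succ n ih =>
    have hσ : σ ∈ Submonoid.closure
        (Set.range fun i : Fin n => Equiv.swap i.castSucc i.succ) := by
      rw [Equiv.Perm.mclosure_swap_castSucc_succ]; trivial
    have hdiff (k : ℕ) : Differentiable ℝ (iteratedFDeriv ℝ k f) :=
      hf.differentiable_iteratedFDeriv (by exact_mod_cast WithTop.coe_lt_top k)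
    induction hσ using Submonoid.closure_induction generalizing v with
    | one => rfl
    | mul a b _ _ ha hb =>
      rw [Equiv.Perm.coe_mul, ← Function.comp_assoc, hb, ha]
    | mem τ hτ =>
      obtain ⟨i, rfl⟩ := hτ
      cases n with
      | zero => exact i.elim0
      | succ n =>
      refine Fin.cases ?_ (fun j => ?_) i
      · rw [iteratedFDeriv_succ_apply_left, iteratedFDeriv_succ_apply_left]
        have hn : ContDiff ℝ ∞ (iteratedFDeriv ℝ n f) :=
          hf.iteratedFDeriv_right (i := n) (m := ∞) (by exact_mod_cast le_top)
        have key (u : Fin (n + 1 + 1) → E) :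
            fderiv ℝ (iteratedFDeriv ℝ (n + 1) f) x (u 0) (Fin.tail u) =
            fderiv ℝ (fderiv ℝ (iteratedFDeriv ℝ n f)) x (u 0) (u 1) (Fin.tail (Fin.tail u)) := by
          have hg : Differentiable ℝ (fderiv ℝ (iteratedFDeriv ℝ n f)) :=
            (hn.fderiv_right (m := ∞) le_rfl).differentiable (by simp)
          rw [← fderiv_continuousMultilinear_apply_const_apply (hdiff _ x)]
          simp_rw [iteratedFDeriv_succ_apply_left]
          have h2 := ((hg x).hasFDerivAt.clm_apply
            (hasFDerivAt_const (Fin.tail u 0) x)).continuousMultilinear_apply_const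
              (Fin.tail (Fin.tail u))
          rw [h2.fderiv]
          simp [Fin.tail]
        rw [key, key]
        have hs : IsSymmSndFDerivAt ℝ (iteratedFDeriv ℝ n f) x :=
          hn.contDiffAt.isSymmSndFDerivAt
            (by rw [minSmoothness_of_isRCLikeNormedField]
                exact WithTop.coe_le_coe.2 (le_top (a := (2 : ℕ∞))))
        rw [hs.eq]
        congr 2
      · rw [(hdiff _ x).iteratedFDeriv_succ_apply_left', (hdiff _ x).iteratedFDeriv_succ_apply_left']
        have h0 : (v ∘ Equiv.swap j.succ.castSucc j.succ.succ) 0 = v 0 := by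
          simp only [Function.comp]
          rw [Equiv.swap_apply_of_ne_of_ne] <;> simp [Fin.ext_iff]
        have h1 : Fin.tail (v ∘ Equiv.swap j.succ.castSucc j.succ.succ) =
            Fin.tail v ∘ Equiv.swap j.castSucc j.succ := by
          ext l
          simp only [Fin.tail, Function.comp]
          congr 1
          rw [← Fin.succ_castSucc]
          exact ((Fin.succ_injective _).map_swap _ _ _).symm
        rw [h0, h1]
        simp_rw [ih]
end

section
variable {E V : Type u} [NormedAddCommGroup E] [NormedSpace ℝ E]
  [NormedAddCommGroup V] [NormedSpace ℝ V]

open ContinuousLinearMap (inl inr)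

/-- Mixed partial derivatives as values of the full derivative. -/
theorem iteratedFDeriv_iteratedFDeriv_partial_apply {f : E × E → V} {U : Set (E × E)}
    (hU : IsOpen U) (hf : ContDiffOn ℝ ∞ f U) {x ξ : E} (hx : (x, ξ) ∈ U) (n k : ℕ)
    (v : Fin n → E) (w : Fin k → E) :
    iteratedFDeriv ℝ n (fun y => iteratedFDeriv ℝ k (fun η => f (y, η)) ξ) x v w =
      iteratedFDeriv ℝ (n + k) f (x, ξ)
        (Fin.append (inl ℝ E E ∘ v) (inr ℝ E E ∘ w)) := by
  let Λ : ContinuousMultilinearMap ℝ (fun _ : Fin k => E × E) V →L[ℝ]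
      ContinuousMultilinearMap ℝ (fun _ : Fin k => E) V :=
    ContinuousMultilinearMap.compContinuousLinearMapL fun _ => inr ℝ E E
  have hk := hf.iteratedFDeriv_infty_of_isOpen hU k
  have hloc : (fun y => iteratedFDeriv ℝ k (fun η => f (y, η)) ξ) =ᶠ[nhds x]
      Λ ∘ fun y => iteratedFDeriv ℝ k f ((0, ξ) + inl ℝ E E y) := by
    have : ∀ᶠ y in nhds x, (y, ξ) ∈ U :=
      (hU.preimage (by fun_prop : Continuous fun y : E => (y, ξ))).mem_nhds hx
    filter_upwards [this] with y hy
    have h := iteratedFDeriv_comp_affine hU hf (inr ℝ E E) (y, 0) ξ (by simpa using hy) k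
    simpa [Λ] using h
  rw [(hloc.iteratedFDeriv ℝ n).eq_of_nhds]
  have hsm : ContDiffAt ℝ ∞ (fun y => iteratedFDeriv ℝ k f ((0, ξ) + inl ℝ E E y)) x := by
    refine ContDiffAt.comp x (g := iteratedFDeriv ℝ k f) ?_ (by fun_prop)
    exact hk.contDiffAt (hU.mem_nhds (by simpa using hx))
  rw [Λ.iteratedFDeriv_comp_left hsm (by exact_mod_cast le_top),
    iteratedFDeriv_comp_affine hU hk (inl ℝ E E) (0, ξ) x (by simpa using hx) n]
  have h := iteratedFDeriv_iteratedFDeriv_apply f (x, ξ) n k (inl ℝ E E ∘ v) (inr ℝ E E ∘ w)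
  rw [← h]
  simp [Λ]
  rfl

theorem norm_iteratedFDeriv_piecewise_le {f : E × E → V} (hf : ContDiff ℝ ∞ f) {x ξ : E}
    {m n k : ℕ} (hm : m = n + k) (S : Finset (Fin m)) (hS : S.card = n) {B : ℝ}
    (hB : ‖iteratedFDeriv ℝ n (fun y => iteratedFDeriv ℝ k (fun η => f (y, η)) ξ) x‖ ≤ B)
    (v w : Fin m → E) {a b : ℝ} {c : Fin m → ℝ}
    (hv : ∀ i, ‖v i‖ ≤ a * c i) (hw : ∀ i, ‖w i‖ ≤ b * c i) :
    ‖iteratedFDeriv ℝ m f (x, ξ) (S.piecewise (inl ℝ E E ∘ v) (inr ℝ E E ∘ w))‖ ≤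
      B * a ^ n * b ^ k * ∏ i, c i := by
  subst hm
  have hSc : Sᶜ.card = k := by rw [Finset.card_compl, hS]; simp
  let τ : Equiv.Perm (Fin (n + k)) := finSumFinEquiv.symm.trans (finSumEquivOfFinset hS hSc)
  let e₁ : Fin n → Fin (n + k) := fun i => τ (Fin.castAdd k i)
  let e₂ : Fin k → Fin (n + k) := fun i => τ (Fin.natAdd n i)
  have hτ : S.piecewise (inl ℝ E E ∘ v) (inr ℝ E E ∘ w) ∘ τ =
      Fin.append (inl ℝ E E ∘ v ∘ e₁) (inr ℝ E E ∘ w ∘ e₂) := by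
    ext1 i
    refine Fin.addCases (fun i => ?_) (fun i => ?_) i
    · have : τ (Fin.castAdd k i) ∈ S := by
        simp [τ]
      simp only [Function.comp_apply, Fin.append_left]
      rw [Finset.piecewise_eq_of_mem _ _ _ this]
      rfl
    · have : τ (Fin.natAdd n i) ∉ S := by
        rw [← Finset.mem_compl]
        simp [τ]
      simp only [Function.comp_apply, Fin.append_right]
      rw [Finset.piecewise_eq_of_notMem _ _ _ this]
      rfl
  rw [← hf.iteratedFDeriv_comp_perm_infty _ τ, hτ,
    ← iteratedFDeriv_iteratedFDeriv_partial_apply isOpen_univ hf.contDiffOn (Set.mem_univ _)]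
  have hB0 : 0 ≤ B := (norm_nonneg _).trans hB
  have hc : ∏ i, c i = (∏ i, c (e₁ i)) * ∏ i, c (e₂ i) := by
    rw [← Equiv.prod_comp τ, Fin.prod_univ_add]
  calc _ ≤ ‖iteratedFDeriv ℝ n (fun y => iteratedFDeriv ℝ k (fun η => f (y, η)) ξ) x (v ∘ e₁)‖
          * ∏ i, ‖w (e₂ i)‖ := ContinuousMultilinearMap.le_opNorm _ _
    _ ≤ (B * ∏ i, ‖v (e₁ i)‖) * ∏ i, ‖w (e₂ i)‖ := by
      gcongr
      exact ContinuousMultilinearMap.le_of_opNorm_le hB (v ∘ e₁)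
    _ ≤ (B * ∏ i, (a * c (e₁ i))) * ∏ i, (b * c (e₂ i)) := by
      have h1 : ∏ i, ‖v (e₁ i)‖ ≤ ∏ i, (a * c (e₁ i)) :=
        Finset.prod_le_prod (fun _ _ => norm_nonneg _) fun _ _ => hv _
      have h2 : ∏ i, ‖w (e₂ i)‖ ≤ ∏ i, (b * c (e₂ i)) :=
        Finset.prod_le_prod (fun _ _ => norm_nonneg _) fun _ _ => hw _
      have h3 : 0 ≤ ∏ i, ‖w (e₂ i)‖ := Finset.prod_nonneg fun _ _ => norm_nonneg _
      have h4 : 0 ≤ ∏ i, ‖v (e₁ i)‖ := Finset.prod_nonneg fun _ _ => norm_nonneg _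
      have h5 := h4.trans h1
      gcongr
    _ = _ := by
      rw [hc, Finset.prod_mul_distrib, Finset.prod_mul_distrib]
      simp
      ring

/-- The dilation by `a` in the first variable and by `b` in the second one. -/
noncomputable def dilation (E : Type u) [NormedAddCommGroup E] [NormedSpace ℝ E] (a b : ℝ) :
    E × E →L[ℝ] E × E :=
  (a • ContinuousLinearMap.id ℝ E).prodMap (b • ContinuousLinearMap.id ℝ E)

@[simp]
theorem dilation_apply (a b : ℝ) (p : E × E) : dilation E a b p = (a • p.1, b • p.2) := rfl

/-- Bounds on mixed partial derivatives bound the full derivative in rescaled coordinates. -/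
theorem norm_iteratedFDeriv_dilation_apply_le {f : E × E → V} (hf : ContDiff ℝ ∞ f) {x ξ : E}
    {m : ℕ} {B a b : ℝ} (ha : 0 < a) (hb : 0 < b)
    (hB : ∀ n k, n + k = m →
      ‖iteratedFDeriv ℝ n (fun y => iteratedFDeriv ℝ k (fun η => f (y, η)) ξ) x‖ * a ^ n * b ^ k
        ≤ B) (u : Fin m → E × E) :
    ‖iteratedFDeriv ℝ m f (x, ξ) (fun i => dilation E a b (u i))‖ ≤ 2 ^ m * B * ∏ i, ‖u i‖ := by
  have hu : (fun i => dilation E a b (u i)) =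
      (inl ℝ E E ∘ fun i => a • (u i).1) + (inr ℝ E E ∘ fun i => b • (u i).2) := by
    ext i <;> simp
  rw [hu, ContinuousMultilinearMap.map_add_univ]
  refine (norm_sum_le _ _).trans ?_
  have key (S : Finset (Fin m)) :
      ‖iteratedFDeriv ℝ m f (x, ξ) (S.piecewise (inl ℝ E E ∘ fun i => a • (u i).1)
        (inr ℝ E E ∘ fun i => b • (u i).2))‖ ≤ B * ∏ i, ‖u i‖ := by
    have hcard : m = S.card + Sᶜ.card := by rw [Finset.card_add_card_compl]; simp
    refine (norm_iteratedFDeriv_piecewise_le hf hcard S rfl le_rfl _ _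
      (a := a) (b := b) (c := fun i => ‖u i‖) (fun i => ?_) (fun i => ?_)).trans ?_
    · rw [norm_smul, Real.norm_of_nonneg ha.le]
      exact mul_le_mul_of_nonneg_left (norm_fst_le _) ha.le
    · rw [norm_smul, Real.norm_of_nonneg hb.le]
      exact mul_le_mul_of_nonneg_left (norm_snd_le _) hb.le
    · exact mul_le_mul_of_nonneg_right (hB _ _ hcard.symm)
        (Finset.prod_nonneg fun _ _ => norm_nonneg _)
  refine (Finset.sum_le_card_nsmul _ _ _ fun S _ => key S).trans ?_
  simp [mul_assoc]

end

section
variable {α H V : Type*} [MeasurableSpace α] {μ : Measure α} [NormedAddCommGroup H]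
  [NormedSpace ℝ H] [NormedAddCommGroup V] [NormedSpace ℝ V]

set_option maxSynthPendingDepth 3 in
/-- Smoothness of an integral depending on a parameter. -/
theorem contDiffOn_integral_of_locally_dominated {f : α → H → V} {U : Set H} (hU : IsOpen U)
    (hf : ∀ a, ContDiffOn ℝ ∞ (f a) U)
    (hmeas : ∀ n : ℕ, ∀ q ∈ U, AEStronglyMeasurable (fun a => iteratedFDeriv ℝ n (f a) q) μ)
    (hdom : ∀ n : ℕ, ∀ q ∈ U, ∃ s ∈ nhds q, ∃ g : α → ℝ, Integrable g μ ∧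
      ∀ᵐ a ∂μ, ∀ q' ∈ s, ‖iteratedFDeriv ℝ n (f a) q'‖ ≤ g a) :
    ContDiffOn ℝ ∞ (fun q => ∫ a, f a q ∂μ) U ∧ ∀ n : ℕ, ∀ q ∈ U,
      iteratedFDeriv ℝ n (fun q => ∫ a, f a q ∂μ) q = ∫ a, iteratedFDeriv ℝ n (f a) q ∂μ := by
  have hint (n : ℕ) (q) (hq : q ∈ U) : Integrable (fun a => iteratedFDeriv ℝ n (f a) q) μ := by
    obtain ⟨s, hs, g, hg, hb⟩ := hdom n q hq
    refine hg.mono' (hmeas n q hq) ?_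
    filter_upwards [hb] with a ha using ha q (mem_of_mem_nhds hs)
  have hcurry (n : ℕ) (a : α) (q : H) : fderiv ℝ (iteratedFDeriv ℝ n (f a)) q =
      continuousMultilinearCurryLeftEquiv ℝ (fun _ : Fin (n + 1) => H) V
        (iteratedFDeriv ℝ (n + 1) (f a) q) := rfl
  have hderiv (n : ℕ) (q) (hq : q ∈ U) :
      HasFDerivAt (fun q => ∫ a, iteratedFDeriv ℝ n (f a) q ∂μ)
        (∫ a, iteratedFDeriv ℝ (n + 1) (f a) q ∂μ).curryLeft q := by
    obtain ⟨s, hs, g, hg, hb⟩ := hdom (n + 1) q hq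
    have h := hasFDerivAt_integral_of_dominated_of_fderiv_le (μ := μ) (bound := g) (x₀ := q)
      (F := fun q a => iteratedFDeriv ℝ n (f a) q)
      (F' := fun q a => fderiv ℝ (iteratedFDeriv ℝ n (f a)) q)
      (Filter.inter_mem hs (hU.mem_nhds hq))
      (by filter_upwards [hU.mem_nhds hq] with q' hq' using hmeas n q' hq')
      (hint n q hq)
      (by
        simp_rw [hcurry]
        exact (LinearIsometryEquiv.continuous _).comp_aestronglyMeasurable (hmeas (n + 1) q hq))
      (by
        filter_upwards [hb] with a ha q' hq'
        rw [hcurry, LinearIsometryEquiv.norm_map]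
        exact ha q' hq'.1) hg
      (by
        filter_upwards with a q' hq'
        exact ((((hf a).contDiffAt (hU.mem_nhds hq'.2)).iteratedFDeriv_right (i := n) (m := 1)
          (by exact_mod_cast le_top)).differentiableAt (by simp)).hasFDerivAt)
    have hint' : Integrable (fun a => fderiv ℝ (iteratedFDeriv ℝ n (f a)) q) μ :=
      (LinearIsometryEquiv.integrable_comp_iff (𝕜 := ℝ)
        (φ := fun a => iteratedFDeriv ℝ (n + 1) (f a) q)
        (continuousMultilinearCurryLeftEquiv ℝ (fun _ : Fin (n + 1) => H) V)).2 (hint (n + 1) q hq)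
    suffices heq : (∫ a, iteratedFDeriv ℝ (n + 1) (f a) q ∂μ).curryLeft =
        ∫ a, fderiv ℝ (iteratedFDeriv ℝ n (f a)) q ∂μ by
      rw [heq]; exact h
    ext v w
    rw [ContinuousLinearMap.integral_apply hint', ContinuousMultilinearMap.integral_apply
      (hint'.apply_continuousLinearMap v)]
    change (∫ a, iteratedFDeriv ℝ (n + 1) (f a) q ∂μ) (Fin.cons v w) = _
    rw [ContinuousMultilinearMap.integral_apply (hint (n + 1) q hq)]
    rfl
  have hT : HasFTaylorSeriesUpToOn ∞ (fun q => ∫ a, f a q ∂μ)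
      (fun q n => ∫ a, iteratedFDeriv ℝ n (f a) q ∂μ) U := by
    refine ⟨fun q hq => ?_, fun n _ q hq => (hderiv n q hq).hasFDerivWithinAt,
      fun n _ q hq => (hderiv n q hq).continuousAt.continuousWithinAt⟩
    change (∫ a, iteratedFDeriv ℝ 0 (f a) q ∂μ) 0 = _
    rw [ContinuousMultilinearMap.integral_apply (hint 0 q hq)]
    rfl
  refine ⟨hT.contDiffOn, fun n q hq => ?_⟩
  have := hT.eq_iteratedFDerivWithin_of_uniqueDiffOn (m := n) (by exact_mod_cast le_top)
    hU.uniqueDiffOn hq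
  rw [← iteratedFDerivWithin_of_isOpen n hU hq, ← this]
end

section
variable {E : Type*} [NormedAddCommGroup E] [InnerProductSpace ℝ E]

/-- Pairs of a position and a nonzero covector which are not incoming. -/
def outgoingRegion (E : Type*) [NormedAddCommGroup E] [InnerProductSpace ℝ E] (R ε : ℝ) :
    Set (E × E) :=
  {p | p.2 ≠ 0 ∧ (R ≤ ‖p.1‖ → -1 + ε ≤ ⟪‖p.1‖⁻¹ • p.1, ‖p.2‖⁻¹ • p.2⟫)}

/-- Flow along the normalized covector for time `t`. -/
noncomputable def rayMap (t : ℝ) (q : E × E) : E × E :=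
  (q.1 + t • (‖q.2‖⁻¹ • q.2), q.2)

theorem mem_outgoingRegion_iff {R ε : ℝ} (hR : 0 < R) {x ξ : E} :
    (x, ξ) ∈ outgoingRegion E R ε ↔
      ξ ≠ 0 ∧ (R ≤ ‖x‖ → (-1 + ε) * ‖x‖ ≤ ⟪x, ‖ξ‖⁻¹ • ξ⟫) := by
  refine and_congr_right fun _ => forall_congr' fun h => ?_
  have hx : 0 < ‖x‖ := hR.trans_le h
  rw [real_inner_smul_left, ← div_eq_inv_mul, le_div_iff₀ hx]

theorem norm_inv_smul_self {ξ : E} (hξ : ξ ≠ 0) : ‖‖ξ‖⁻¹ • ξ‖ = 1 := by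
  rw [norm_smul, norm_inv, norm_norm, inv_mul_cancel₀ (norm_ne_zero_iff.2 hξ)]

theorem norm_add_smul_sq {w : E} (hw : ‖w‖ = 1) (x : E) (t : ℝ) :
    ‖x + t • w‖ ^ 2 = ‖x‖ ^ 2 + 2 * t * ⟪x, w⟫ + t ^ 2 := by
  rw [norm_add_sq_real, real_inner_smul_right, norm_smul, hw, Real.norm_eq_abs, mul_one, sq_abs]
  ring

theorem inner_add_smul_self {w : E} (hw : ‖w‖ = 1) (x : E) (t : ℝ) :
    ⟪x + t • w, w⟫ = ⟪x, w⟫ + t := by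
  rw [inner_add_left, real_inner_smul_left, real_inner_self_eq_norm_sq, hw]
  ring

theorem rayMap_mem_outgoingRegion {R ε : ℝ} (hR : 0 < R) (hε1 : ε < 1) {p : E × E}
    (hp : p ∈ outgoingRegion E R ε) {t : ℝ} (ht : 0 ≤ t) :
    rayMap t p ∈ outgoingRegion E R ε := by
  obtain ⟨x, ξ⟩ := p
  rw [mem_outgoingRegion_iff hR] at hp
  obtain ⟨hξ, hp⟩ := hp
  refine (mem_outgoingRegion_iff hR).2 ⟨hξ, fun h => ?_⟩
  dsimp only at h ⊢
  have hw := norm_inv_smul_self hξ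
  set w := ‖ξ‖⁻¹ • ξ
  rw [inner_add_smul_self hw]
  have hN := norm_add_smul_sq hw x t
  set N' := ‖x + t • w‖
  have hN'0 : 0 ≤ N' := norm_nonneg _
  set a := ⟪x, w⟫
  rcases le_or_gt 0 (a + t) with hb | hb
  · nlinarith
  have ha : a ^ 2 ≤ ‖x‖ ^ 2 := by
    rw [sq_le_sq, abs_norm]
    simpa [hw] using abs_real_inner_le_norm x w
  have hle : N' ≤ ‖x‖ := by
    refine le_of_sq_le_sq ?_ (norm_nonneg _)
    nlinarith
  have hx := hp (h.trans hle)
  have hk : a ^ 2 ≤ (1 - ε) ^ 2 * ‖x‖ ^ 2 := by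
    rw [← mul_pow]
    exact sq_le_sq' (by linarith) (by nlinarith [norm_nonneg x])
  suffices -(a + t) ≤ (1 - ε) * N' by linarith
  refine le_of_sq_le_sq ?_ (by nlinarith)
  rw [mul_pow, hN]
  have hb2 : (a + t) ^ 2 ≤ a ^ 2 := by nlinarith
  by_cases h1 : (1 - ε) ^ 2 ≤ 1
  · nlinarith
  · nlinarith

theorem rayMap_mem_outgoingRegion_of_two_mul_norm_le {R ε : ℝ} (hR : 0 < R) (hε1 : ε < 1)
    {x ξ : E} (hξ : ξ ≠ 0) {t : ℝ} (ht : 2 * ‖x‖ ≤ t) :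
    rayMap t (x, ξ) ∈ outgoingRegion E R ε := by
  refine (mem_outgoingRegion_iff hR).2 ⟨hξ, fun _ => ?_⟩
  have hw := norm_inv_smul_self hξ
  dsimp only
  rw [inner_add_smul_self hw]
  have h1 := abs_real_inner_le_norm x (‖ξ‖⁻¹ • ξ)
  rw [hw, mul_one] at h1
  nlinarith [abs_le.1 h1, norm_nonneg x, norm_nonneg (x + t • (‖ξ‖⁻¹ • ξ))]

theorem sub_norm_le_norm_rayMap_fst {x ξ : E} (hξ : ξ ≠ 0) (t : ℝ) :
    t - ‖x‖ ≤ ‖(rayMap t (x, ξ)).1‖ := by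
  have h := norm_sub_norm_le (t • (‖ξ‖⁻¹ • ξ)) (-x)
  rw [norm_neg, norm_smul t, norm_inv_smul_self hξ, mul_one, sub_neg_eq_add, add_comm _ x] at h
  exact (sub_le_sub_right (le_abs_self t) _).trans h

theorem exists_mul_le_one_add_norm_rayMap {R ε : ℝ} (hR : 0 < R) (hε : 0 < ε) (hε1 : ε < 1) :
    ∃ c > 0, ∀ p ∈ outgoingRegion E R ε, ∀ t ≥ 0,
      c * (1 + ‖p.1‖ + t) ≤ 1 + ‖(rayMap t p).1‖ := by
  refine ⟨min (ε / 2) (1 + 2 * R)⁻¹, by positivity, ?_⟩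
  rintro ⟨x, ξ⟩ hp t ht
  rw [mem_outgoingRegion_iff hR] at hp
  obtain ⟨hξ, hp⟩ := hp
  have hx0 := norm_nonneg x
  have hsub := sub_norm_le_norm_rayMap_fst (x := x) hξ t
  have hN0 := norm_nonneg (rayMap t (x, ξ)).1
  have hN := norm_add_smul_sq (norm_inv_smul_self hξ) x t
  change ‖(rayMap t (x, ξ)).1‖ ^ 2 = _ at hN
  set N := ‖(rayMap t (x, ξ)).1‖
  dsimp only
  rcases le_or_gt R ‖x‖ with h | h
  · have h1 := mul_le_mul_of_nonneg_left (hp h) ht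
    have h2 : ε / 2 * (‖x‖ + t) ≤ N := by
      refine le_of_sq_le_sq ?_ hN0
      rw [hN]
      have h3 : ε * (‖x‖ ^ 2 + t ^ 2) ≤ ‖x‖ ^ 2 + 2 * t * ⟪x, ‖ξ‖⁻¹ • ξ⟫ + t ^ 2 := by
        nlinarith [mul_nonneg (sub_nonneg.2 hε1.le) (sq_nonneg (‖x‖ - t))]
      refine le_trans ?_ h3
      have h4 : (ε / 2) ^ 2 ≤ ε / 2 := by nlinarith
      calc (ε / 2 * (‖x‖ + t)) ^ 2 = (ε / 2) ^ 2 * (‖x‖ + t) ^ 2 := by ring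
        _ ≤ ε / 2 * (‖x‖ + t) ^ 2 := by gcongr
        _ ≤ _ := by nlinarith [sq_nonneg (‖x‖ - t)]
    calc _ ≤ ε / 2 * (1 + ‖x‖ + t) := by gcongr; exact min_le_left _ _
      _ ≤ _ := by nlinarith
  · calc _ ≤ (1 + 2 * R)⁻¹ * (1 + ‖x‖ + t) := by gcongr; exact min_le_right _ _
      _ ≤ _ := by
        rw [inv_mul_le_iff₀ (by positivity)]
        rcases le_or_gt t R with h' | h'
        · nlinarith
        · nlinarith
end

theorem isOpen_snd_ne_zero {E : Type*} [NormedAddCommGroup E] : IsOpen {q : E × E | q.2 ≠ 0} :=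
  isOpen_ne.preimage continuous_snd

section
variable {E V : Type u} [NormedAddCommGroup E] [InnerProductSpace ℝ E]
  [NormedAddCommGroup V] [NormedSpace ℝ V]

theorem contDiffOn_normalize_snd :
    ContDiffOn ℝ ∞ (fun q : E × E => ‖q.2‖⁻¹ • q.2) {q | q.2 ≠ 0} := by
  intro q hq
  have hn : ContDiffAt ℝ ∞ (fun q : E × E => ‖q.2‖) q := contDiffAt_snd.norm ℝ hq
  exact ((hn.inv (norm_ne_zero_iff.2 hq)).smul contDiffAt_snd).contDiffWithinAt

/-- Derivatives of the ray map in rescaled coordinates are uniformly bounded. -/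
theorem exists_norm_iteratedFDeriv_rescaled_ray_le [ProperSpace E] (K : ℝ) (m : ℕ) :
    ∃ D : ℝ, 1 ≤ D ∧ ∀ a b : ℝ, |a| ≤ K → |b| ≤ K →
      ∀ q ∈ Metric.closedBall (0 : E) 1 ×ˢ Metric.sphere (0 : E) 1, ∀ i, 1 ≤ i → i ≤ m →
        ‖iteratedFDeriv ℝ i (fun q : E × E => (a • q.1 + b • (‖q.2‖⁻¹ • q.2), q.2)) q‖
          ≤ D ^ i := by
  let H : E × E → E × E × E := fun q => (q.1, ‖q.2‖⁻¹ • q.2, q.2)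
  have hH : ContDiffOn ℝ ∞ H {q | q.2 ≠ 0} :=
    contDiffOn_fst.prodMk (contDiffOn_normalize_snd.prodMk contDiffOn_snd)
  let S : Set (E × E) := Metric.closedBall (0 : E) 1 ×ˢ Metric.sphere (0 : E) 1
  have hS : IsCompact S := (isCompact_closedBall _ _).prod (isCompact_sphere _ _)
  have hSU : S ⊆ {q | q.2 ≠ 0} := fun q hq => ne_zero_of_mem_unit_sphere ⟨q.2, hq.2⟩
  have hB (i : ℕ) : ∃ B, ∀ q ∈ S, ‖iteratedFDeriv ℝ i H q‖ ≤ B :=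
    hS.exists_bound_of_continuousOn
      ((hH.iteratedFDeriv_infty_of_isOpen isOpen_snd_ne_zero i).continuousOn.mono hSU)
  choose B hB using hB
  let D : ℝ := 1 + (2 * |K| + 1) * ∑ i ∈ Finset.range (m + 1), |B i|
  have hsum : 0 ≤ ∑ i ∈ Finset.range (m + 1), |B i| := Finset.sum_nonneg fun _ _ => abs_nonneg _
  have hD : 1 ≤ D := by
    have : 0 ≤ (2 * |K| + 1) * ∑ i ∈ Finset.range (m + 1), |B i| := by positivity
    simpa [D] using this
  refine ⟨D, hD, fun a b ha hb q hq i hi him => ?_⟩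
  let L : E × E × E →L[ℝ] E × E :=
    ((a • ContinuousLinearMap.fst ℝ E (E × E)) +
      b • (ContinuousLinearMap.fst ℝ E E).comp (ContinuousLinearMap.snd ℝ E (E × E))).prod
      ((ContinuousLinearMap.snd ℝ E E).comp (ContinuousLinearMap.snd ℝ E (E × E)))
  have hL : ‖L‖ ≤ 2 * |K| + 1 := by
    refine L.opNorm_le_bound (by positivity) fun z => ?_
    have h1 : ‖z.1‖ ≤ ‖z‖ := norm_fst_le z
    have h2 : ‖z.2.1‖ ≤ ‖z‖ := (norm_fst_le z.2).trans (norm_snd_le z)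
    have h3 : ‖z.2.2‖ ≤ ‖z‖ := (norm_snd_le z.2).trans (norm_snd_le z)
    have haK := ha.trans (le_abs_self K)
    have hbK := hb.trans (le_abs_self K)
    refine max_le ?_ ?_
    · calc ‖a • z.1 + b • z.2.1‖ ≤ |a| * ‖z.1‖ + |b| * ‖z.2.1‖ := by
            refine (norm_add_le _ _).trans_eq ?_
            rw [norm_smul, norm_smul, Real.norm_eq_abs, Real.norm_eq_abs]
        _ ≤ |K| * ‖z‖ + |K| * ‖z‖ := by gcongr
        _ ≤ _ := by nlinarith [norm_nonneg z]
    · calc ‖z.2.2‖ ≤ ‖z‖ := h3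
        _ ≤ _ := by nlinarith [norm_nonneg z, abs_nonneg K]
  have heq : (fun q : E × E => (a • q.1 + b • (‖q.2‖⁻¹ • q.2), q.2)) = L ∘ H := rfl
  rw [heq, L.iteratedFDeriv_comp_left (hH.contDiffAt (isOpen_snd_ne_zero.mem_nhds (hSU hq)))
    (by exact_mod_cast le_top)]
  calc _ ≤ ‖L‖ * ‖iteratedFDeriv ℝ i H q‖ := L.norm_compContinuousMultilinearMap_le _
    _ ≤ (2 * |K| + 1) * ∑ i ∈ Finset.range (m + 1), |B i| := by
      gcongr
      refine ((hB i q hq).trans (le_abs_self _)).trans ?_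
      exact Finset.single_le_sum (f := fun i => |B i|) (fun _ _ => abs_nonneg _)
        (Finset.mem_range.2 (Nat.lt_succ_of_le him))
    _ ≤ D := by simp [D]
    _ ≤ D ^ i := le_self_pow₀ hD (by lia)

/-- If the derivatives of `f` at the end point of a ray are bounded in coordinates rescaled by `σ`,
then those of `f ∘ rayMap t` are bounded in coordinates rescaled by `r`, provided `r` and `t` are
controlled by `σ`. -/
theorem exists_norm_iteratedFDeriv_comp_rayMap_le [ProperSpace E] (K : ℝ) (m : ℕ) :
    ∃ M : ℝ, 0 ≤ M ∧ ∀ f : E × E → V, ContDiff ℝ ∞ f → ∀ x ξ : E, ξ ≠ 0 → ∀ t r σ B : ℝ,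
      0 < r → 0 < σ → ‖x‖ ≤ r → |t| ≤ K * σ → r ≤ K * σ → 0 ≤ B →
      (∀ i ≤ m, ∀ u : Fin i → E × E, ‖iteratedFDeriv ℝ i f (rayMap t (x, ξ))
        (fun j => dilation E σ ‖ξ‖ (u j))‖ ≤ B * ∏ j, ‖u j‖) →
      ∀ u : Fin m → E × E, ‖iteratedFDeriv ℝ m (f ∘ rayMap t) (x, ξ)
        (fun j => dilation E r ‖ξ‖ (u j))‖ ≤ M * B * ∏ j, ‖u j‖ := by
  obtain ⟨D, hD1, hD⟩ := exists_norm_iteratedFDeriv_rescaled_ray_le (E := E) K m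
  refine ⟨m.factorial * D ^ m, by positivity, ?_⟩
  intro f hf x ξ hξ t r σ B hr hσ hxr ht hrK hB hfB u
  have hs : 0 < ‖ξ‖ := norm_pos_iff.2 hξ
  set s := ‖ξ‖
  let φ : E × E → E × E := fun q => ((r / σ) • q.1 + (t / σ) • (‖q.2‖⁻¹ • q.2), q.2)
  let q₀ : E × E := (r⁻¹ • x, s⁻¹ • ξ)
  have hray : ContDiffOn ℝ ∞ (f ∘ rayMap t) {q | q.2 ≠ 0} :=
    hf.comp_contDiffOn ((contDiffOn_fst.add (contDiffOn_normalize_snd.const_smul t)).prodMk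
      contDiffOn_snd)
  have hφ : ContDiffOn ℝ ∞ φ {q | q.2 ≠ 0} :=
    ((contDiffOn_fst.const_smul _).add (contDiffOn_normalize_snd.const_smul _)).prodMk
      contDiffOn_snd
  have hconj : (fun q => (f ∘ rayMap t) (0 + dilation E r s q)) =
      (fun z => f (0 + dilation E σ s z)) ∘ φ := by
    ext q
    have h1 : ‖s • q.2‖⁻¹ • s • q.2 = ‖q.2‖⁻¹ • q.2 := by
      rw [norm_smul, Real.norm_of_nonneg hs.le, smul_smul]
      congr 1
      field_simp
    simp only [zero_add, Function.comp_apply, rayMap, dilation_apply, φ, h1, smul_add, smul_smul]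
    congr 4
    · field_simp
    · field_simp
  have hq₀ : q₀.2 ≠ 0 := smul_ne_zero (inv_ne_zero hs.ne') hξ
  have hdil : 0 + dilation E r s q₀ = (x, ξ) := by
    simp [q₀, smul_smul, hr.ne', hs.ne']
  have hdil' : 0 + dilation E σ s (φ q₀) = rayMap t (x, ξ) := by
    have h1 : ‖s⁻¹ • ξ‖⁻¹ = 1 := by rw [norm_inv_smul_self hξ, inv_one]
    have h2 : σ * (r / σ * r⁻¹) = 1 := by field_simp
    have h3 : σ * (t / σ * s⁻¹) = t * s⁻¹ := by field_simp
    have h4 : s * s⁻¹ = 1 := mul_inv_cancel₀ hs.ne'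
    simp only [φ, q₀, rayMap, dilation_apply, zero_add, h1, smul_add, smul_smul, h2, h3,
      h4, one_smul, mul_one]
    rfl
  have hmem : q₀ ∈ Metric.closedBall (0 : E) 1 ×ˢ Metric.sphere (0 : E) 1 := by
    refine ⟨?_, ?_⟩
    · rw [mem_closedBall_zero_iff, norm_smul, norm_inv, Real.norm_of_nonneg hr.le,
        inv_mul_le_iff₀ hr, mul_one]
      exact hxr
    · rw [mem_sphere_zero_iff_norm]
      exact norm_inv_smul_self hξ
  have hcomp := norm_iteratedFDerivWithin_comp_le (n := m) (N := ∞)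
    (g := fun z => f (0 + dilation E σ s z)) (f := φ) (s := {q | q.2 ≠ 0}) (t := Set.univ)
    (hf.comp (by fun_prop)).contDiffOn hφ (by exact_mod_cast le_top) uniqueDiffOn_univ
    isOpen_snd_ne_zero.uniqueDiffOn (Set.mapsTo_univ _ _) hq₀ (C := B) (D := D)
    (fun i hi => by
      rw [iteratedFDerivWithin_univ,
        iteratedFDeriv_comp_affine isOpen_univ hf.contDiffOn _ _ _ (Set.mem_univ _), hdil']
      exact ContinuousMultilinearMap.opNorm_le_bound hB (hfB i hi))
    (fun i hi him => by
      rw [iteratedFDerivWithin_of_isOpen i isOpen_snd_ne_zero hq₀]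
      refine hD _ _ ?_ ?_ _ hmem i hi him
      · rw [abs_div, abs_of_pos hr, abs_of_pos hσ]
        exact (div_le_iff₀ hσ).2 hrK
      · rw [abs_div, abs_of_pos hσ]
        exact (div_le_iff₀ hσ).2 ht)
  rw [← hconj, iteratedFDerivWithin_of_isOpen m isOpen_snd_ne_zero hq₀,
    iteratedFDeriv_comp_affine isOpen_snd_ne_zero hray _ _ _ (by rw [hdil]; exact hξ), hdil] at hcomp
  refine (ContinuousMultilinearMap.le_of_opNorm_le hcomp u).trans_eq ?_
  ring
end

section
variable {E V : Type u} [NormedAddCommGroup E] [InnerProductSpace ℝ E]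
  [NormedAddCommGroup V] [NormedSpace ℝ V]

/-- Symbol estimates of order `-ρ` in the first and `0` in the second variable on a region. -/
def IsSymbolOn (ρ : ℝ) (Ξ : Set (E × E)) (f : E × E → V) : Prop :=
  ∀ n k : ℕ, ∃ C : ℝ, ∀ p ∈ Ξ,
    ‖iteratedFDeriv ℝ n (fun x => iteratedFDeriv ℝ k (fun ξ => f (x, ξ)) p.2) p.1‖
      ≤ C * (1 + ‖p.1‖) ^ (-ρ - (n : ℝ)) * ‖p.2‖ ^ (-(k : ℝ))

theorem IsSymbolOn.exists_norm_iteratedFDeriv_dilation_le {ρ : ℝ} {Ξ : Set (E × E)} {f : E × E → V}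
    (h : IsSymbolOn ρ Ξ f) (hf : ContDiff ℝ ∞ f) (hΞ : ∀ p ∈ Ξ, p.2 ≠ 0) (m : ℕ) :
    ∃ C : ℝ, 0 ≤ C ∧ ∀ p ∈ Ξ, ∀ i ≤ m, ∀ u : Fin i → E × E,
      ‖iteratedFDeriv ℝ i f p (fun j => dilation E (1 + ‖p.1‖) ‖p.2‖ (u j))‖
        ≤ C * (1 + ‖p.1‖) ^ (-ρ) * ∏ j, ‖u j‖ := by
  choose C hC using h
  let s := Finset.range (m + 1) ×ˢ Finset.range (m + 1)
  let A := ∑ j ∈ s, |C j.1 j.2|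
  have hA : 0 ≤ A := Finset.sum_nonneg fun _ _ => abs_nonneg _
  refine ⟨2 ^ m * A, by positivity, fun p hp i hi u => ?_⟩
  have ha : 0 < 1 + ‖p.1‖ := by positivity
  have hb : 0 < ‖p.2‖ := norm_pos_iff.2 (hΞ p hp)
  refine (norm_iteratedFDeriv_dilation_apply_le (B := A * (1 + ‖p.1‖) ^ (-ρ)) hf ha hb
    (fun n k hnk => ?_) u).trans ?_
  · have hCA : C n k ≤ A := (le_abs_self _).trans
      (Finset.single_le_sum (f := fun j : ℕ × ℕ => |C j.1 j.2|) (a := (n, k))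
        (fun _ _ => abs_nonneg _)
        (Finset.mem_product.2 ⟨Finset.mem_range.2 (by lia), Finset.mem_range.2 (by lia)⟩))
    calc _ ≤ C n k * (1 + ‖p.1‖) ^ (-ρ - (n : ℝ)) * ‖p.2‖ ^ (-(k : ℝ))
            * (1 + ‖p.1‖) ^ n * ‖p.2‖ ^ k := by
          gcongr
          exact hC n k p hp
      _ = C n k * (1 + ‖p.1‖) ^ (-ρ) := by
          rw [Real.rpow_sub ha, Real.rpow_natCast, Real.rpow_neg hb.le, Real.rpow_natCast]
          field_simp
      _ ≤ _ := by gcongr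
  · rw [← mul_assoc]
    gcongr
    norm_num

theorem exists_norm_iteratedFDeriv_comp_rayMap_le_rpow [ProperSpace E] {ρ : ℝ} {Ξ : Set (E × E)}
    {f : E × E → V} (h : IsSymbolOn ρ Ξ f) (hf : ContDiff ℝ ∞ f) (hΞ : ∀ p ∈ Ξ, p.2 ≠ 0)
    (K : ℝ) (m : ℕ) :
    ∃ M : ℝ, 0 ≤ M ∧ ∀ p : E × E, ∀ t r : ℝ, rayMap t p ∈ Ξ → 0 < r → ‖p.1‖ ≤ r →
      |t| ≤ K * (1 + ‖(rayMap t p).1‖) → r ≤ K * (1 + ‖(rayMap t p).1‖) →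
      ∀ u : Fin m → E × E, ‖iteratedFDeriv ℝ m (f ∘ rayMap t) p
        (fun j => dilation E r ‖p.2‖ (u j))‖
          ≤ M * (1 + ‖(rayMap t p).1‖) ^ (-ρ) * ∏ j, ‖u j‖ := by
  obtain ⟨C, hC0, hC⟩ := h.exists_norm_iteratedFDeriv_dilation_le hf hΞ m
  obtain ⟨M, hM0, hM⟩ := exists_norm_iteratedFDeriv_comp_rayMap_le (E := E) (V := V) K m
  refine ⟨M * C, by positivity, fun p t r hp hr hpr ht hrK u => ?_⟩
  refine (hM f hf p.1 p.2 (hΞ (rayMap t p) hp) t r (1 + ‖(rayMap t p).1‖)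
    (C * (1 + ‖(rayMap t p).1‖) ^ (-ρ)) hr (by positivity) hpr ht hrK (by positivity)
    (fun i hi u => hC _ hp i hi u) u).trans_eq ?_
  ring

theorem contDiffOn_comp_rayMap_uncurry {f : E × E → V} (hf : ContDiff ℝ ∞ f) :
    ContDiffOn ℝ ∞ (fun z : ℝ × E × E => f (rayMap z.1 z.2)) {z | z.2.2 ≠ 0} := by
  have h : ContDiffOn ℝ ∞ (fun z : ℝ × E × E => ‖z.2.2‖⁻¹ • z.2.2) {z | z.2.2 ≠ 0} :=
    contDiffOn_normalize_snd.comp contDiffOn_snd fun _ hz => hz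
  exact hf.comp_contDiffOn (((contDiff_fst.comp contDiff_snd).contDiffOn.add
    (contDiffOn_fst.smul h)).prodMk (contDiff_snd.comp contDiff_snd).contDiffOn)

theorem contDiffOn_comp_rayMap {f : E × E → V} (hf : ContDiff ℝ ∞ f) (t : ℝ) :
    ContDiffOn ℝ ∞ (f ∘ rayMap t) {q | q.2 ≠ 0} :=
  (contDiffOn_comp_rayMap_uncurry hf).comp (contDiff_prodMk_right t).contDiffOn fun _ hq => hq

theorem continuousOn_iteratedFDeriv_comp_rayMap {f : E × E → V} (hf : ContDiff ℝ ∞ f) (n : ℕ) :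
    ContinuousOn (fun z : ℝ × E × E => iteratedFDeriv ℝ n (f ∘ rayMap z.1) z.2)
      {z | z.2.2 ≠ 0} := by
  have hU : IsOpen {z : ℝ × E × E | z.2.2 ≠ 0} := isOpen_snd_ne_zero.preimage continuous_snd
  have hΦ := contDiffOn_comp_rayMap_uncurry hf
  let A := ContinuousLinearMap.inr ℝ ℝ (E × E)
  refine ((ContinuousMultilinearMap.compContinuousLinearMapL (fun _ : Fin n => A)).continuous
    |>.comp_continuousOn (hΦ.iteratedFDeriv_infty_of_isOpen hU n).continuousOn).congr ?_
  rintro ⟨t, q⟩ hz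
  have h := iteratedFDeriv_comp_affine hU hΦ A (t, 0) q (by simpa [A] using hz) n
  simpa [A, Function.comp_def] using h

theorem exists_dominating_iteratedFDeriv_comp_rayMap [ProperSpace E] {R ε ρ : ℝ} (hR : 0 < R)
    (hε1 : ε < 1) (hρ : 1 < ρ) {f : E × E → V} (h : IsSymbolOn ρ (outgoingRegion E R ε) f)
    (hf : ContDiff ℝ ∞ f) (n : ℕ) {q : E × E} (hq : q.2 ≠ 0) :
    ∃ s ∈ nhds q, ∃ g : ℝ → ℝ, IntegrableOn g (Set.Ioi 0) ∧
      ∀ t > 0, ∀ q' ∈ s, ‖iteratedFDeriv ℝ n (f ∘ rayMap t) q'‖ ≤ g t := by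
  let δ := ‖q.2‖ / 2
  have hδ : 0 < δ := half_pos (norm_pos_iff.2 hq)
  let s := Metric.closedBall q δ
  have hs2 (q') (hq' : q' ∈ s) : δ ≤ ‖q'.2‖ := by
    have h1 : ‖q.2 - q'.2‖ ≤ δ :=
      (norm_snd_le (q - q')).trans (by rw [← dist_eq_norm, dist_comm]; exact hq')
    have h2 := norm_sub_norm_le q.2 q'.2
    have h3 : ‖q.2‖ = 2 * δ := by simp only [δ]; ring
    linarith
  let A := ‖q.1‖ + δ
  have hA : 0 ≤ A := by positivity
  have hs1 (q') (hq' : q' ∈ s) : ‖q'.1‖ ≤ A := by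
    have h1 : ‖q'.1 - q.1‖ ≤ δ :=
      (norm_fst_le (q' - q)).trans (by rw [← dist_eq_norm]; exact hq')
    have h2 := norm_sub_norm_le q'.1 q.1
    simp only [A]
    linarith
  let T := 2 * (1 + A)
  obtain ⟨B, hB⟩ := (isCompact_Icc (a := (0 : ℝ)) (b := T)).prod (isCompact_closedBall q δ)
    |>.exists_bound_of_continuousOn
      ((continuousOn_iteratedFDeriv_comp_rayMap hf n).mono fun z hz =>
        norm_pos_iff.1 (hδ.trans_le (hs2 _ hz.2)))
  obtain ⟨M, hM0, hM⟩ := exists_norm_iteratedFDeriv_comp_rayMap_le_rpow h hf (fun p hp => hp.1) 2 n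
  refine ⟨s, Metric.closedBall_mem_nhds q hδ,
    fun t => (M * (1 + δ⁻¹) ^ n * 2 ^ ρ + |B| * (T + 1) ^ ρ) * (t + 1) ^ (-ρ),
    (integrableOn_add_rpow_Ioi_of_lt (by linarith) (by norm_num)).const_mul _, ?_⟩
  intro t ht q' hq'
  have hT : 0 < T + 1 := by positivity
  have ht1 : 0 < t + 1 := by linarith
  beta_reduce
  rw [add_mul]
  rcases le_or_gt t T with htT | htT
  · have h1 : 1 ≤ (T + 1) ^ ρ * (t + 1) ^ (-ρ) := by
      rw [Real.rpow_neg ht1.le, ← div_eq_mul_inv, one_le_div (by positivity)]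
      gcongr
    calc _ ≤ |B| := (hB (t, q') ⟨⟨ht.le, htT⟩, hq'⟩).trans (le_abs_self B)
      _ ≤ |B| * ((T + 1) ^ ρ * (t + 1) ^ (-ρ)) := le_mul_of_one_le_right (abs_nonneg B) h1
      _ = |B| * (T + 1) ^ ρ * (t + 1) ^ (-ρ) := by ring
      _ ≤ _ := le_add_of_nonneg_left (by positivity)
  · have hξ : q'.2 ≠ 0 := norm_pos_iff.1 (hδ.trans_le (hs2 _ hq'))
    have hx := hs1 q' hq'
    have hσ := sub_norm_le_norm_rayMap_fst (x := q'.1) hξ t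
    change t - ‖q'.1‖ ≤ ‖(rayMap t q').1‖ at hσ
    have hM' := hM q' t (1 + A) (rayMap_mem_outgoingRegion_of_two_mul_norm_le hR hε1 hξ
      (by simp only [T] at htT; linarith)) (by positivity) (by linarith)
      (by rw [abs_of_pos ht]; simp only [T] at htT; linarith)
      (by simp only [T] at htT; linarith)
    set σ := 1 + ‖(rayMap t q').1‖
    have hσt : (t + 1) / 2 ≤ σ := by simp only [T] at htT; simp only [σ]; linarith
    have hσρ : σ ^ (-ρ) ≤ 2 ^ ρ * (t + 1) ^ (-ρ) := by
      refine (Real.rpow_le_rpow_of_nonpos (by positivity) hσt (by linarith)).trans_eq ?_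
      rw [Real.div_rpow ht1.le (by norm_num), Real.rpow_neg (by norm_num : (0 : ℝ) ≤ 2)]
      field_simp
    refine ContinuousMultilinearMap.opNorm_le_bound (by positivity) fun v => ?_
    have hinv (w : E × E) :
        dilation E (1 + A) ‖q'.2‖ (dilation E (1 + A)⁻¹ ‖q'.2‖⁻¹ w) = w := by
      have h1 : (1 + A) ≠ 0 := by positivity
      have h2 := norm_ne_zero_iff.2 hξ
      simp [smul_smul, h1, h2]
    have hle (w : E × E) : ‖dilation E (1 + A)⁻¹ ‖q'.2‖⁻¹ w‖ ≤ (1 + δ⁻¹) * ‖w‖ := by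
      refine max_le ?_ ?_
      · dsimp only [dilation_apply]
        rw [norm_smul, norm_inv, Real.norm_of_nonneg (by positivity)]
        have h1 : (1 + A)⁻¹ ≤ 1 := inv_le_one_of_one_le₀ (by linarith)
        have h2 : 0 ≤ δ⁻¹ := by positivity
        gcongr
        · linarith
        · exact norm_fst_le w
      · dsimp only [dilation_apply]
        rw [norm_smul, norm_inv, norm_norm]
        have h1 : ‖q'.2‖⁻¹ ≤ δ⁻¹ := by gcongr; exact hs2 _ hq'
        gcongr
        · linarith
        · exact norm_snd_le w
    have hv := hM' fun j => dilation E (1 + A)⁻¹ ‖q'.2‖⁻¹ (v j)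
    simp only [hinv] at hv
    calc _ ≤ M * σ ^ (-ρ) * ∏ j, ‖dilation E (1 + A)⁻¹ ‖q'.2‖⁻¹ (v j)‖ := hv
      _ ≤ M * (2 ^ ρ * (t + 1) ^ (-ρ)) * ∏ j, ((1 + δ⁻¹) * ‖v j‖) := by
        gcongr with j
        exact hle _
      _ = M * (1 + δ⁻¹) ^ n * 2 ^ ρ * (t + 1) ^ (-ρ) * ∏ j, ‖v j‖ := by
        rw [Finset.prod_mul_distrib]
        simp
        ring
      _ ≤ _ := by
        gcongr
        exact le_add_of_nonneg_right (by positivity)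
end

section
variable {E V : Type u} [NormedAddCommGroup E] [InnerProductSpace ℝ E]
  [NormedAddCommGroup V] [NormedSpace ℝ V]

theorem continuous_rayMap (p : E × E) : Continuous fun t : ℝ => rayMap t p := by
  unfold rayMap
  fun_prop

theorem IsSymbolOn.integrableOn_comp_rayMap [ProperSpace E] {R ε ρ : ℝ} (hR : 0 < R) (hε1 : ε < 1)
    (hρ : 1 < ρ) {f : E × E → V} (h : IsSymbolOn ρ (outgoingRegion E R ε) f)
    (hf : ContDiff ℝ ∞ f) {p : E × E} (hp : p.2 ≠ 0) :
    IntegrableOn (fun t : ℝ => f (rayMap t p)) (Set.Ioi 0) := by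
  obtain ⟨s, hs, g, hg, hb⟩ := exists_dominating_iteratedFDeriv_comp_rayMap hR hε1 hρ h hf 0 hp
  refine hg.mono' (hf.continuous.comp (continuous_rayMap p)).aestronglyMeasurable
    (ae_restrict_of_forall_mem measurableSet_Ioi fun t ht => ?_)
  simpa using hb t ht p (mem_of_mem_nhds hs)

/-- The integral of a symbol along rays is smooth and can be differentiated under the integral. -/
theorem IsSymbolOn.contDiffOn_integral_comp_rayMap [ProperSpace E] {R ε ρ : ℝ} (hR : 0 < R)
    (hε1 : ε < 1) (hρ : 1 < ρ) {f : E × E → V} (h : IsSymbolOn ρ (outgoingRegion E R ε) f)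
    (hf : ContDiff ℝ ∞ f) :
    ContDiffOn ℝ ∞ (fun q => ∫ t in Set.Ioi (0 : ℝ), f (rayMap t q)) {q | q.2 ≠ 0} ∧
      ∀ n : ℕ, ∀ q ∈ {q : E × E | q.2 ≠ 0},
        iteratedFDeriv ℝ n (fun q => ∫ t in Set.Ioi (0 : ℝ), f (rayMap t q)) q =
          ∫ t in Set.Ioi (0 : ℝ), iteratedFDeriv ℝ n (f ∘ rayMap t) q := by
  refine contDiffOn_integral_of_locally_dominated (f := fun t => f ∘ rayMap t)
    isOpen_snd_ne_zero (contDiffOn_comp_rayMap hf) (fun n q hq => ?_) (fun n q hq => ?_)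
  · exact ((continuousOn_iteratedFDeriv_comp_rayMap hf n).comp_continuous
      (Continuous.prodMk_left q) fun _ => hq).aestronglyMeasurable
  · obtain ⟨s, hs, g, hg, hb⟩ := exists_dominating_iteratedFDeriv_comp_rayMap hR hε1 hρ h hf n hq
    exact ⟨s, hs, g, hg, ae_restrict_of_forall_mem measurableSet_Ioi hb⟩

theorem hasDerivAt_integral_Ioi_comp_add [CompleteSpace V] {φ : ℝ → V} (hφ : Continuous φ)
    (hint : IntegrableOn φ (Set.Ioi 0)) :
    HasDerivAt (fun h => ∫ t in Set.Ioi (0 : ℝ), φ (t + h)) (-φ 0) 0 := by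
  have heq (h : ℝ) : ∫ t in Set.Ioi (0 : ℝ), φ (t + h) =
      (∫ t in Set.Ioi (0 : ℝ), φ t) - ∫ t in (0 : ℝ)..h, φ t := by
    have h1 := (measurePreserving_add_right volume h).setIntegral_preimage_emb
      (measurableEmbedding_addRight h) φ (Set.Ioi h)
    rw [Set.preimage_add_const_Ioi, sub_self] at h1
    rw [h1, ← intervalIntegral.integral_interval_add_Ioi' (hφ.intervalIntegrable h 0) hint,
      intervalIntegral.integral_symm]
    abel
  simp_rw [heq]
  exact (intervalIntegral.integral_hasDerivAt_right (hφ.intervalIntegrable 0 0)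
    hφ.aestronglyMeasurable.stronglyMeasurableAtFilter hφ.continuousAt).const_sub _

/-- The integral of a symbol along rays solves the transport equation. -/
theorem IsSymbolOn.fderiv_integral_comp_rayMap [ProperSpace E] [CompleteSpace V] {R ε ρ : ℝ}
    (hR : 0 < R) (hε1 : ε < 1) (hρ : 1 < ρ) {f : E × E → V}
    (h : IsSymbolOn ρ (outgoingRegion E R ε) f) (hf : ContDiff ℝ ∞ f) {x ξ : E} (hξ : ξ ≠ 0) :
    fderiv ℝ (fun x => ∫ t in Set.Ioi (0 : ℝ), f (rayMap t (x, ξ))) x (‖ξ‖⁻¹ • ξ)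
      = -f (x, ξ) := by
  set w := ‖ξ‖⁻¹ • ξ with hw
  have hd : DifferentiableAt ℝ (fun x => ∫ t in Set.Ioi (0 : ℝ), f (rayMap t (x, ξ))) x :=
    (((h.contDiffOn_integral_comp_rayMap hR hε1 hρ hf).1.contDiffAt
      (isOpen_snd_ne_zero.mem_nhds (x := (x, ξ)) hξ)).differentiableAt (by simp)).comp
      (f := fun x : E => (x, ξ)) x (by fun_prop)
  have hline : HasDerivAt (fun s : ℝ => x + s • w) w 0 := by
    simpa using ((hasDerivAt_id (0 : ℝ)).smul_const w).const_add x
  have h1 := HasFDerivAt.comp_hasDerivAt (0 : ℝ)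
    (l := fun x => ∫ t in Set.Ioi (0 : ℝ), f (rayMap t (x, ξ))) (f := fun s : ℝ => x + s • w)
    (by simpa using hd.hasFDerivAt) hline
  have h2 := hasDerivAt_integral_Ioi_comp_add (hf.continuous.comp (continuous_rayMap (x, ξ)))
    (h.integrableOn_comp_rayMap hR hε1 hρ hf hξ)
  have h3 : (fun s : ℝ => ∫ t in Set.Ioi (0 : ℝ), (f ∘ fun t => rayMap t (x, ξ)) (t + s)) =
      (fun x => ∫ t in Set.Ioi (0 : ℝ), f (rayMap t (x, ξ))) ∘ fun s : ℝ => x + s • w := by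
    ext s
    simp only [Function.comp_apply, rayMap, ← hw, add_smul, add_assoc, add_comm (s • w)]
  rw [h3] at h2
  simpa [rayMap] using h1.unique h2

theorem integral_Ioi_add_rpow_of_lt {a r : ℝ} (ha : a < -1) (hr : 0 < r) :
    ∫ t in Set.Ioi (0 : ℝ), (t + r) ^ a = -r ^ (a + 1) / (a + 1) := by
  have h1 := (measurePreserving_add_right volume r).setIntegral_preimage_emb
    (measurableEmbedding_addRight r) (fun t => t ^ a) (Set.Ioi r)
  rw [Set.preimage_add_const_Ioi, sub_self] at h1
  rw [h1, integral_Ioi_rpow_of_lt ha hr]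

/-- Integration along rays loses one order of decay. -/
theorem IsSymbolOn.integral_comp_rayMap [ProperSpace E] {R ε ρ : ℝ} (hR : 0 < R) (hε : 0 < ε)
    (hε1 : ε < 1) (hρ : 1 < ρ) {f : E × E → V} (h : IsSymbolOn ρ (outgoingRegion E R ε) f)
    (hf : ContDiff ℝ ∞ f) :
    IsSymbolOn (ρ - 1) (outgoingRegion E R ε)
      (fun q => ∫ t in Set.Ioi (0 : ℝ), f (rayMap t q)) := by
  intro n k
  obtain ⟨hsm, hder⟩ := h.contDiffOn_integral_comp_rayMap hR hε1 hρ hf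
  obtain ⟨c, hc0, hc⟩ := exists_mul_le_one_add_norm_rayMap (E := E) hR hε hε1
  obtain ⟨M, hM0, hM⟩ := exists_norm_iteratedFDeriv_comp_rayMap_le_rpow h hf (fun p hp => hp.1)
    c⁻¹ (n + k)
  refine ⟨M * c ^ (-ρ) / (ρ - 1), ?_⟩
  rintro ⟨x, ξ⟩ hp
  have hξ : ξ ≠ 0 := hp.1
  have hs : 0 < ‖ξ‖ := norm_pos_iff.2 hξ
  have hρ1 : 0 < ρ - 1 := by linarith
  have hr : 0 < 1 + ‖x‖ := by positivity
  dsimp only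
  set s := ‖ξ‖
  set r := 1 + ‖x‖ with hrx
  let u (v : Fin n → E) (w : Fin k → E) : Fin (n + k) → E × E :=
    Fin.append (ContinuousLinearMap.inl ℝ E E ∘ v) (ContinuousLinearMap.inr ℝ E E ∘ w)
  have hu (v : Fin n → E) (w : Fin k → E) :
      u v w = fun j => dilation E r s (u (r⁻¹ • v) (s⁻¹ • w) j) := by
    ext1 j
    refine Fin.addCases (fun i => ?_) (fun i => ?_) j
    · simp [u, smul_smul, hr.ne']
    · simp [u, smul_smul, hs.ne']
  have hprod (v : Fin n → E) (w : Fin k → E) : ∏ j, ‖u (r⁻¹ • v) (s⁻¹ • w) j‖ =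
      (r ^ n)⁻¹ * (s ^ k)⁻¹ * (∏ i, ‖v i‖) * ∏ i, ‖w i‖ := by
    rw [Fin.prod_univ_add]
    have hl (y : E) : ‖ContinuousLinearMap.inl ℝ E E y‖ = ‖y‖ := by simp
    have hr' (y : E) : ‖ContinuousLinearMap.inr ℝ E E y‖ = ‖y‖ := by simp
    simp only [u, Fin.append_left, Fin.append_right, Function.comp_apply, Pi.smul_apply, hl, hr',
      norm_smul, norm_inv, Real.norm_of_nonneg hr.le, Real.norm_of_nonneg hs.le,
      Finset.prod_mul_distrib, Finset.prod_const, Finset.card_univ, Fintype.card_fin]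
    ring
  have hpt (v : Fin n → E) (w : Fin k → E) (t : ℝ) (ht : 0 < t) :
      ‖iteratedFDeriv ℝ (n + k) (f ∘ rayMap t) (x, ξ) (u v w)‖ ≤
        M * c ^ (-ρ) * ((r ^ n)⁻¹ * (s ^ k)⁻¹ * (∏ i, ‖v i‖) * ∏ i, ‖w i‖) *
          (t + r) ^ (-ρ) := by
    have hσ := hc (x, ξ) hp t ht.le
    set σ := 1 + ‖(rayMap t (x, ξ)).1‖
    have htr : 0 < t + r := by positivity
    have hσ' : c * (t + r) ≤ σ := by
      refine le_trans (le_of_eq ?_) hσ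
      simp only [hrx]
      ring
    have hσr : t + r ≤ c⁻¹ * σ := by rwa [le_inv_mul_iff₀ hc0]
    rw [hu]
    refine (hM (x, ξ) t r (rayMap_mem_outgoingRegion hR hε1 hp ht.le) hr (by simp [hrx])
      (by rw [abs_of_pos ht]; linarith) (by linarith) _).trans ?_
    rw [hprod]
    have hσρ : σ ^ (-ρ) ≤ c ^ (-ρ) * (t + r) ^ (-ρ) := by
      rw [← Real.mul_rpow hc0.le htr.le]
      exact Real.rpow_le_rpow_of_nonpos (by positivity) hσ' (by linarith)
    calc _ ≤ M * (c ^ (-ρ) * (t + r) ^ (-ρ)) *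
          ((r ^ n)⁻¹ * (s ^ k)⁻¹ * (∏ i, ‖v i‖) * ∏ i, ‖w i‖) := by gcongr
      _ = _ := by ring
  have hQ : M * c ^ (-ρ) / (ρ - 1) * r ^ (-(ρ - 1) - (n : ℝ)) * s ^ (-(k : ℝ)) =
      M * c ^ (-ρ) * ((r ^ n)⁻¹ * (s ^ k)⁻¹) * (-r ^ (-ρ + 1) / (-ρ + 1)) := by
    rw [Real.rpow_sub hr, Real.rpow_natCast, Real.rpow_neg hs.le, Real.rpow_natCast, neg_sub,
      show -ρ + 1 = -(ρ - 1) by ring, neg_div_neg_eq, ← neg_sub ρ 1]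
    field_simp
  have hQ0 : 0 ≤ M * c ^ (-ρ) / (ρ - 1) * r ^ (-(ρ - 1) - (n : ℝ)) * s ^ (-(k : ℝ)) := by
    positivity
  refine ContinuousMultilinearMap.opNorm_le_bound hQ0 fun v =>
    ContinuousMultilinearMap.opNorm_le_bound (by positivity) fun w => ?_
  have hint : Integrable (fun t => iteratedFDeriv ℝ (n + k) (f ∘ rayMap t) (x, ξ))
      (volume.restrict (Set.Ioi 0)) := by
    obtain ⟨S, hS, g, hg, hb⟩ :=
      exists_dominating_iteratedFDeriv_comp_rayMap hR hε1 hρ h hf (n + k) (q := (x, ξ)) hξ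
    refine hg.mono' ?_ (ae_restrict_of_forall_mem measurableSet_Ioi fun t ht =>
      hb t ht _ (mem_of_mem_nhds hS))
    exact ((continuousOn_iteratedFDeriv_comp_rayMap hf (n + k)).comp_continuous
      (Continuous.prodMk_left (x, ξ)) fun _ => hξ).aestronglyMeasurable
  rw [iteratedFDeriv_iteratedFDeriv_partial_apply isOpen_snd_ne_zero hsm hξ, hder _ _ hξ,
    ContinuousMultilinearMap.integral_apply hint]
  refine (norm_integral_le_of_norm_le
    ((integrableOn_add_rpow_Ioi_of_lt (by linarith) (by linarith)).const_mul _)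
    (ae_restrict_of_forall_mem measurableSet_Ioi (hpt v w))).trans_eq ?_
  rw [integral_const_mul, integral_Ioi_add_rpow_of_lt (by linarith) hr, hQ]
  ring
end

end

/-- Transport/eikonal lemma: if a smooth symbol `F` satisfies the short-range
estimates `|∂ₓ^α ∂_ξ^β F| ≤ C(1+|x|)^{−ρ−|α|}|ξ|^{−|β|}` (`ρ > 1`) on the
outgoing region `Ξ⁺`, then `d(x,ξ) = ∫₀^∞ F(x+tω,ξ)dt` (with `ω = ξ/|ξ|`)
converges, solves `⟨ω,∇ₓd⟩ = −F`, and satisfies the same estimates with `ρ`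
replaced by `ρ−1`. -/
theorem transport_lemma (R ε₀ ρ : ℝ) (hR : 0 < R) (hε₀ : 0 < ε₀) (hε₀1 : ε₀ < 1)
    (hρ : 1 < ρ)
    (F : EuclideanSpace ℝ (Fin 3) → EuclideanSpace ℝ (Fin 3) → ℂ)
    (hF : ContDiff ℝ (⊤ : ℕ∞) (Function.uncurry F))
    (Ξ : Set (EuclideanSpace ℝ (Fin 3) × EuclideanSpace ℝ (Fin 3)))
    (hΞ : Ξ = {p | p.2 ≠ 0 ∧ (R ≤ ‖p.1‖ →
      -1 + ε₀ ≤ ⟪‖p.1‖⁻¹ • p.1, ‖p.2‖⁻¹ • p.2⟫)})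
    (hbound : ∀ n k : ℕ, ∃ C : ℝ, ∀ p ∈ Ξ,
      ‖iteratedFDeriv ℝ n
          (fun x => iteratedFDeriv ℝ k (fun ξ => F x ξ) p.2) p.1‖
        ≤ C * (1 + ‖p.1‖) ^ (-ρ - (n : ℝ)) * ‖p.2‖ ^ (-(k : ℝ))) :
    (∀ p ∈ Ξ, IntegrableOn
        (fun t : ℝ => F (p.1 + t • (‖p.2‖⁻¹ • p.2)) p.2) (Set.Ioi 0)) ∧
    (∀ p ∈ Ξ,
      (fderiv ℝ
          (fun x => ∫ t in Set.Ioi (0 : ℝ), F (x + t • (‖p.2‖⁻¹ • p.2)) p.2) p.1)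
          (‖p.2‖⁻¹ • p.2)
        = - F p.1 p.2) ∧
    (∀ n k : ℕ, ∃ C : ℝ, ∀ p ∈ Ξ,
      ‖iteratedFDeriv ℝ n
          (fun x => iteratedFDeriv ℝ k
            (fun ξ => ∫ t in Set.Ioi (0 : ℝ), F (x + t • (‖ξ‖⁻¹ • ξ)) ξ) p.2) p.1‖
        ≤ C * (1 + ‖p.1‖) ^ (-(ρ - 1) - (n : ℝ)) * ‖p.2‖ ^ (-(k : ℝ))) := by
  have hfs : IsSymbolOn ρ (outgoingRegion _ R ε₀) (Function.uncurry F) := by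
    rw [hΞ] at hbound
    exact hbound
  refine ⟨fun p hp => ?_, fun p hp => ?_, ?_⟩
  · rw [hΞ] at hp
    exact hfs.integrableOn_comp_rayMap hR hε₀1 hρ hF hp.1
  · rw [hΞ] at hp
    exact hfs.fderiv_integral_comp_rayMap hR hε₀1 hρ hF (x := p.1) hp.1
  · rw [hΞ]
    exact hfs.integral_comp_rayMap hR hε₀ hε₀1 hρ hF
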